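/- Let h be a Dirichlet form on L_2(ℝ^d) and, for a fixed nonnegative ξ ∈ D(h) ∩ L_∞, define the truncated form h_ξ(φ,ψ) = (1/2)(h(ξφ,ψ) + h(φ,ξψ) − h(ξ,φψ)) for φ, ψ ∈ D(h) ∩ L_∞(ℝ^d). Then 0 ≤ h_ξ(φ) ≤ ‖ξ‖_∞ h(φ) for all φ ∈ D(h) ∩ L_∞(ℝ^d). -/

import Mathlib

open Real MeasureTheory

/-- An abstract (symmetric, Markovian) Dirichlet form on functions on `ℝ^d`, with domain
`dom` and bilinear form `bilin`. -/
structure DirichletForm (d : ℕ) where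
  dom : Set (EuclideanSpace ℝ (Fin d) → ℝ)
  bilin : (EuclideanSpace ℝ (Fin d) → ℝ) → (EuclideanSpace ℝ (Fin d) → ℝ) → ℝ
  dom_add : ∀ {φ ψ}, φ ∈ dom → ψ ∈ dom → φ + ψ ∈ dom
  dom_smul : ∀ (a : ℝ) {φ}, φ ∈ dom → a • φ ∈ dom
  symm : ∀ φ ψ, bilin φ ψ = bilin ψ φ
  add_left : ∀ φ ψ χ, bilin (φ + ψ) χ = bilin φ χ + bilin ψ χ
  smul_left : ∀ (a : ℝ) φ ψ, bilin (a • φ) ψ = a * bilin φ ψ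
  nonneg : ∀ φ ∈ dom, 0 ≤ bilin φ φ
  /-- Markovian (Dirichlet) property: unit contractions operate on the form. -/
  markov : ∀ φ ∈ dom, ∀ F : ℝ → ℝ, LipschitzWith 1 F → F 0 = 0 →
    F ∘ φ ∈ dom ∧ bilin (F ∘ φ) (F ∘ φ) ≤ bilin φ φ

namespace DirichletForm

variable {d : ℕ} (h : DirichletForm d) {f g : EuclideanSpace ℝ (Fin d) → ℝ}

lemma add_right (f g k : EuclideanSpace ℝ (Fin d) → ℝ) :
    h.bilin f (g + k) = h.bilin f g + h.bilin f k := by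
  rw [h.symm, h.add_left, h.symm g, h.symm k]

lemma smul_right (a : ℝ) (f g : EuclideanSpace ℝ (Fin d) → ℝ) :
    h.bilin f (a • g) = a * h.bilin f g := by
  rw [h.symm, h.smul_left, h.symm g]

lemma sub_left (f g k : EuclideanSpace ℝ (Fin d) → ℝ) :
    h.bilin (f - g) k = h.bilin f k - h.bilin g k := by
  rw [show f - g = f + (-1 : ℝ) • g by ext; simp [sub_eq_add_neg], h.add_left, h.smul_left]
  ring

lemma sub_right (f g k : EuclideanSpace ℝ (Fin d) → ℝ) :
    h.bilin f (g - k) = h.bilin f g - h.bilin f k := by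
  rw [h.symm, h.sub_left, h.symm g, h.symm k]

lemma zero_left (f : EuclideanSpace ℝ (Fin d) → ℝ) : h.bilin 0 f = 0 := by
  simpa using h.smul_left 0 0 f

lemma zero_right (f : EuclideanSpace ℝ (Fin d) → ℝ) : h.bilin f 0 = 0 := by
  rw [h.symm, h.zero_left]

variable {h}

lemma sub_mem (hf : f ∈ h.dom) (hg : g ∈ h.dom) : f - g ∈ h.dom := by
  rw [show f - g = f + (-1 : ℝ) • g by ext; simp [sub_eq_add_neg]]
  exact h.dom_add hf (h.dom_smul _ hg)

/-- Normal contractions operate on the form. -/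
lemma contraction (hg : g ∈ h.dom) (h1 : ∀ x y, |f x - f y| ≤ |g x - g y|)
    (h2 : ∀ x, |f x| ≤ |g x|) : f ∈ h.dom ∧ h.bilin f f ≤ h.bilin g g := by
  let F : Option (EuclideanSpace ℝ (Fin d)) → ℝ := fun o => o.elim 0 f
  let G : Option (EuclideanSpace ℝ (Fin d)) → ℝ := fun o => o.elim 0 g
  have key : ∀ a b, |F a - F b| ≤ |G a - G b| := by
    rintro (_ | a) (_ | b) <;> simp [F, G, h1, h2]
  have hfac : F.FactorsThrough G := by
    intro a b hab
    have := key a b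
    rw [hab, sub_self, abs_zero] at this
    exact sub_eq_zero.1 (abs_nonpos_iff.1 this)
  have hlip : LipschitzOnWith 1 (Function.extend G F 0) (Set.range G) := by
    refine LipschitzOnWith.of_dist_le_mul ?_
    rintro _ ⟨a, rfl⟩ _ ⟨b, rfl⟩
    rw [hfac.extend_apply, hfac.extend_apply]
    simpa [Real.dist_eq] using key a b
  obtain ⟨T, hT, hTe⟩ := hlip.extend_real
  have hTG : ∀ a, T (G a) = F a := fun a => by
    rw [← hTe ⟨a, rfl⟩, hfac.extend_apply]
  have hTg : T ∘ g = f := funext fun x => hTG (some x)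
  simpa [hTg] using h.markov g hg T hT (hTG none)

lemma bilin_nonneg_of_comonotone (hf : f ∈ h.dom) (hg : g ∈ h.dom)
    (h1 : ∀ x y, 0 ≤ (f x - f y) * (g x - g y)) (h2 : ∀ x, 0 ≤ f x * g x) :
    0 ≤ h.bilin f g := by
  have := (contraction (h := h) (f := f - g) (h.dom_add hf hg)
    (fun x y => sq_le_sq.1 ?_) (fun x => sq_le_sq.1 ?_)).2
  · simp only [h.sub_left, h.sub_right, h.add_left, h.add_right, h.symm g f] at this
    linarith
  · simp only [Pi.sub_apply, Pi.add_apply]; nlinarith [h1 x y]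
  · simp only [Pi.sub_apply, Pi.add_apply]; nlinarith [h2 x]

lemma bilin_nonneg_of_eq_max {K : ℝ} (hf : f ∈ h.dom) (hg : g ∈ h.dom) (hK : 0 ≤ K)
    (hfK : ∀ x, f x ≤ K) (hg0 : ∀ x, 0 ≤ g x) (hfg : ∀ x, g x ≠ 0 → f x = K) :
    0 ≤ h.bilin f g := by
  refine bilin_nonneg_of_comonotone hf hg (fun x y => ?_) (fun x => ?_)
  · by_cases hx : g x = 0 <;> by_cases hy : g y = 0
    · simp [hx, hy]
    · rw [hx, hfg y hy]; nlinarith [hfK x, hg0 y]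
    · rw [hy, hfg x hx]; nlinarith [hfK y, hg0 x]
    · simp [hfg x hx, hfg y hy]
  · by_cases hx : g x = 0
    · simp [hx]
    · rw [hfg x hx]; exact mul_nonneg hK (hg0 x)

lemma bilin_nonpos_of_disjoint (hf : f ∈ h.dom) (hg : g ∈ h.dom) (hf0 : ∀ x, 0 ≤ f x)
    (hg0 : ∀ x, 0 ≤ g x) (hfg : ∀ x, g x ≠ 0 → f x = 0) : h.bilin f g ≤ 0 := by
  have := bilin_nonneg_of_eq_max (h := h) (f := (-1 : ℝ) • f) (h.dom_smul _ hf) hg le_rfl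
    (fun x => by simp [hf0 x]) hg0 (fun x hx => by simp [hfg x hx])
  rw [h.smul_left] at this
  linarith

lemma neg_le_two_mul_bilin {t : ℝ} (ht : 0 < t) (hf : f ∈ h.dom) (hg : g ∈ h.dom) :
    -(t * h.bilin f f + t⁻¹ * h.bilin g g) ≤ 2 * h.bilin f g := by
  have := mul_nonneg (inv_nonneg.2 ht.le) (h.nonneg _ (h.dom_add (h.dom_smul t hf) hg))
  simp only [h.add_left, h.add_right, h.smul_left, h.smul_right, h.symm g f] at this
  field_simp at this ⊢
  linarith

lemma bilin_add_self_le (hf : f ∈ h.dom) (hg : g ∈ h.dom) :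
    h.bilin (f + g) (f + g) ≤ 2 * h.bilin f f + 2 * h.bilin g g := by
  have := h.nonneg _ (sub_mem hf hg)
  simp only [h.sub_left, h.sub_right, h.add_left, h.add_right, h.symm g f] at this ⊢
  linarith

lemma bilin_sub_self_le (hf : f ∈ h.dom) (hg : g ∈ h.dom) :
    h.bilin (f - g) (f - g) ≤ 2 * h.bilin f f + 2 * h.bilin g g := by
  have := h.nonneg _ (h.dom_add hf hg)
  simp only [h.sub_left, h.sub_right, h.add_left, h.add_right, h.symm g f] at this ⊢
  linarith

lemma mul_self_mem {L : ℝ} (hf : f ∈ h.dom) (hL : ∀ x, |f x| ≤ L) :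
    f * f ∈ h.dom ∧ h.bilin (f * f) (f * f) ≤ 4 * L ^ 2 * h.bilin f f := by
  have hL0 : 0 ≤ L := (abs_nonneg _).trans (hL 0)
  obtain ⟨h1, h2⟩ := contraction (h := h) (f := f * f) (g := (2 * L) • f) (h.dom_smul _ hf)
    (fun x y => by
      have hx : |f x * f x - f y * f y| = |f x + f y| * |f x - f y| := by
        rw [← abs_mul]; ring_nf
      have h2 : |2 * L * f x - 2 * L * f y| = 2 * L * |f x - f y| := by
        rw [← mul_sub, abs_mul, abs_of_nonneg (by positivity : 0 ≤ 2 * L)]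
      simp only [Pi.mul_apply, Pi.smul_apply, smul_eq_mul, hx, h2]
      gcongr
      linarith [abs_add_le (f x) (f y), hL x, hL y])
    (fun x => by
      simp only [Pi.mul_apply, Pi.smul_apply, smul_eq_mul, abs_mul, abs_two, abs_of_nonneg hL0]
      gcongr
      linarith [hL x])
  refine ⟨h1, h2.trans_eq ?_⟩
  rw [h.smul_left, h.smul_right]; ring

lemma mul_mem {L : ℝ} (hf : f ∈ h.dom) (hg : g ∈ h.dom) (hfL : ∀ x, |f x| ≤ L)
    (hgL : ∀ x, |g x| ≤ L) :
    f * g ∈ h.dom ∧ h.bilin (f * g) (f * g) ≤ 27 * L ^ 2 * (h.bilin f f + h.bilin g g) := by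
  have hs := h.dom_add hf hg
  obtain ⟨hf1, hf2⟩ := mul_self_mem hf hfL
  obtain ⟨hg1, hg2⟩ := mul_self_mem hg hgL
  obtain ⟨hs1, hs2⟩ := mul_self_mem (L := 2 * L) hs fun x => by
    simp only [Pi.add_apply]; linarith [abs_add_le (f x) (g x), hfL x, hgL x]
  have e : f * g = (1 / 2 : ℝ) • ((f + g) * (f + g) - (f * f + g * g)) := by
    ext x; simp; ring
  have hd := h.dom_add hf1 hg1
  refine ⟨e ▸ h.dom_smul _ (sub_mem hs1 hd), ?_⟩
  have p1 := h.nonneg _ (h.dom_add (h.dom_add hs1 hf1) hg1)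
  have a1 := neg_le_two_mul_bilin one_pos hs1 hf1
  have a2 := neg_le_two_mul_bilin one_pos hs1 hg1
  have a3 := neg_le_two_mul_bilin one_pos hf1 (h.dom_smul (-1) hg1)
  have a4 := mul_le_mul_of_nonneg_left (bilin_add_self_le hf hg) (by positivity : 0 ≤ 16 * L ^ 2)
  rw [e]
  simp only [h.smul_left, h.smul_right, h.sub_left, h.sub_right]
  generalize (f + g) * (f + g) = u at *
  generalize f * f = v at *
  generalize g * g = w at *
  simp only [h.smul_left, h.smul_right, h.add_left, h.add_right, h.symm v u, h.symm w u,
    h.symm w v] at *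
  nlinarith

lemma mul_mem_of_bounded (hf : f ∈ h.dom) (hg : g ∈ h.dom) {L M : ℝ} (hfL : ∀ x, |f x| ≤ L)
    (hgM : ∀ x, |g x| ≤ M) : f * g ∈ h.dom :=
  (mul_mem (L := max L M) hf hg (fun x => (hfL x).trans (le_max_left _ _))
    fun x => (hgM x).trans (le_max_right _ _)).1

lemma abs_mem (hf : f ∈ h.dom) :
    (fun x => |f x|) ∈ h.dom ∧ h.bilin (fun x => |f x|) (fun x => |f x|) ≤ h.bilin f f :=
  contraction hf (fun x y => abs_abs_sub_abs_le_abs_sub (f x) (f y)) (fun x => by simp)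

lemma posPart_mem (hf : f ∈ h.dom) :
    (fun x => max (f x) 0) ∈ h.dom ∧
      h.bilin (fun x => max (f x) 0) (fun x => max (f x) 0) ≤ h.bilin f f :=
  contraction hf (fun x y => by simpa using abs_max_sub_max_le_abs (f x) (f y) 0)
    (fun x => by simpa using abs_max_sub_max_le_abs (f x) 0 0)

lemma min_mem (hf : f ∈ h.dom) (hg : g ∈ h.dom) :
    (fun x => min (f x) (g x)) ∈ h.dom ∧
      h.bilin (fun x => min (f x) (g x)) (fun x => min (f x) (g x)) ≤
        h.bilin f f + h.bilin g g := by
  obtain ⟨h1, h2⟩ := abs_mem (sub_mem hf hg)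
  have e : (fun x => min (f x) (g x)) = (1 / 2 : ℝ) • ((f + g) - fun x => |(f - g) x|) := by
    ext x
    simp only [Pi.sub_apply, Pi.add_apply, Pi.smul_apply, smul_eq_mul]
    rcases le_total (f x) (g x) with hx | hx
    · rw [min_eq_left hx, abs_of_nonpos (by linarith)]; ring
    · rw [min_eq_right hx, abs_of_nonneg (by linarith)]; ring
  have hs := h.dom_add hf hg
  have p := h.nonneg _ (h.dom_add hs h1)
  rw [e]
  refine ⟨h.dom_smul _ (sub_mem hs h1), ?_⟩
  generalize (fun x => |(f - g) x|) = k at *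
  simp only [h.smul_left, h.smul_right, h.add_left, h.add_right, h.sub_left, h.sub_right,
    h.symm g f, h.symm k f, h.symm k g] at *
  linarith

lemma min_const_mem {c : ℝ} (hc : 0 ≤ c) (hf : f ∈ h.dom) :
    (fun x => min (f x) c) ∈ h.dom ∧
      h.bilin (fun x => min (f x) c) (fun x => min (f x) c) ≤ h.bilin f f :=
  contraction hf (fun x y => by simpa using abs_min_sub_min_le_max (f x) c (f y) c)
    (fun x => by simpa [hc] using abs_min_sub_min_le_max (f x) c 0 c)

lemma sub_const_posPart_mem {c : ℝ} (hc : 0 ≤ c) (hf : f ∈ h.dom) :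
    (fun x => max (f x - c) 0) ∈ h.dom ∧
      h.bilin (fun x => max (f x - c) 0) (fun x => max (f x - c) 0) ≤ h.bilin f f :=
  contraction hf (fun x y => by simpa using abs_max_sub_max_le_max (f x - c) 0 (f y - c) 0)
    (fun x => by simpa [hc] using abs_max_sub_max_le_max (f x - c) 0 (0 - c) 0)

lemma min_const_add_sub_const_posPart (f : EuclideanSpace ℝ (Fin d) → ℝ) (c : ℝ) :
    (fun x => min (f x) c) + (fun x => max (f x - c) 0) = f := by
  ext x
  simp only [Pi.add_apply]
  rcases le_total (f x) c with hx | hx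
  · rw [min_eq_left hx, max_eq_right (by linarith)]; ring
  · rw [min_eq_right hx, max_eq_left (by linarith)]; ring

/-- The product `s * ψ` is compared with `min (δ * ψ) s` on a single layer `0 ≤ s ≤ δ`. -/
lemma single_layer {δ X : ℝ} (hδ : 0 < δ) {ψ s : EuclideanSpace ℝ (Fin d) → ℝ}
    (hψ : ψ ∈ h.dom) (hψ0 : ∀ x, 0 ≤ ψ x) (hψ1 : ∀ x, ψ x ≤ 1) (hs : s ∈ h.dom)
    (hs0 : ∀ x, 0 ≤ s x) (hsδ : ∀ x, s x ≤ δ) (hX : h.bilin s s ≤ X) :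
    ∃ E ∈ h.dom, (∀ x, 0 ≤ E x) ∧ (∀ x, E x ≠ 0 → 0 < s x ∧ s x < δ) ∧
      h.bilin E E ≤ 56 * (X + δ ^ 2 * h.bilin ψ ψ) ∧
      -(δ ^ 2 * h.bilin ψ ψ + X + X / (2 * δ ^ 2)) ≤ h.bilin (s * ψ + E) ψ ∧
      -(δ ^ 2 * h.bilin ψ ψ + X + X / (2 * δ ^ 2)) ≤ h.bilin (δ • ψ - s * ψ - E) ψ := by
  have hδψ := h.dom_smul δ hψ
  obtain ⟨hG, hGq⟩ := min_mem hδψ hs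
  obtain ⟨hg, hgq⟩ := posPart_mem (sub_mem hδψ hs)
  obtain ⟨hm, hmq⟩ := mul_mem (L := δ) hs hδψ
    (fun x => abs_le.2 ⟨by linarith [hs0 x], hsδ x⟩)
    (fun x => by
      simp only [Pi.smul_apply, smul_eq_mul]
      rw [abs_of_nonneg (mul_nonneg hδ.le (hψ0 x))]
      nlinarith [hψ1 x])
  set G : EuclideanSpace ℝ (Fin d) → ℝ := fun x => min ((δ • ψ) x) (s x) with hGdef
  set g : EuclideanSpace ℝ (Fin d) → ℝ := fun x => max ((δ • ψ - s) x) 0 with hgdef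
  have em : s * (δ • ψ) = δ • (s * ψ) := by ext x; simp; ring
  have hGg : G + g = δ • ψ := by
    ext x
    simp only [hGdef, hgdef, Pi.add_apply, Pi.sub_apply]
    rcases le_total ((δ • ψ) x) (s x) with hx | hx
    · rw [min_eq_left hx, max_eq_right (by linarith)]; ring
    · rw [min_eq_right hx, max_eq_left (by linarith)]; ring
  have hsψ : s * ψ ∈ h.dom := by
    have := h.dom_smul δ⁻¹ hm
    rwa [em, smul_smul, inv_mul_cancel₀ hδ.ne', one_smul] at this
  have hsψq : h.bilin (s * ψ) (s * ψ) ≤ 27 * (X + δ ^ 2 * h.bilin ψ ψ) := by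
    simp only [em, h.smul_left, h.smul_right] at hmq
    have : δ ^ 2 * h.bilin (s * ψ) (s * ψ) ≤ δ ^ 2 * (27 * (X + δ ^ 2 * h.bilin ψ ψ)) := by
      have := mul_le_mul_of_nonneg_left hX (by positivity : 0 ≤ 27 * δ ^ 2)
      nlinarith
    exact le_of_mul_le_mul_left this (by positivity)
  have hGq' : h.bilin G G ≤ X + δ ^ 2 * h.bilin ψ ψ := by
    simp only [h.smul_left, h.smul_right] at hGq
    linarith
  have hgq' : h.bilin g g ≤ 2 * X + 2 * (δ ^ 2 * h.bilin ψ ψ) := by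
    have := bilin_sub_self_le hδψ hs
    simp only [h.smul_left, h.smul_right] at this
    linarith
  have hdisj : h.bilin (s - G) g ≤ 0 := by
    refine bilin_nonpos_of_disjoint (sub_mem hs hG) hg (fun x => ?_) (fun x => le_max_right _ _)
      (fun x hx => ?_)
    · simp [hGdef]
    · have : s x ≤ (δ • ψ) x := by
        by_contra hlt
        exact hx (max_eq_right (by simp only [Pi.sub_apply]; linarith))
      simp only [Pi.sub_apply, hGdef, min_eq_right this, sub_self]
  have hcross : -(δ * (δ ^ 2 * h.bilin ψ ψ + X + X / (2 * δ ^ 2))) ≤ h.bilin g G := by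
    have h1 := neg_le_two_mul_bilin hδ hg hs
    rw [h.sub_left, h.symm s, h.symm G] at hdisj
    have h2 := mul_le_mul_of_nonneg_left hgq' hδ.le
    have h3 := mul_le_mul_of_nonneg_left hX (inv_nonneg.2 hδ.le)
    have h4 : δ * (X / (2 * δ ^ 2)) = δ⁻¹ * X / 2 := by field_simp
    nlinarith
  have hψe : ψ = δ⁻¹ • (G + g) := by rw [hGg, smul_smul, inv_mul_cancel₀ hδ.ne', one_smul]
  have fin : ∀ k, -(δ * (δ ^ 2 * h.bilin ψ ψ + X + X / (2 * δ ^ 2))) ≤ h.bilin k (δ • ψ) →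
      -(δ ^ 2 * h.bilin ψ ψ + X + X / (2 * δ ^ 2)) ≤ h.bilin k ψ := by
    intro k hk
    rw [h.smul_right] at hk
    exact le_of_mul_le_mul_left (by linarith) hδ
  refine ⟨G - s * ψ, sub_mem hG hsψ, fun x => ?_, fun x hx => ?_, ?_, ?_, ?_⟩
  · simp only [Pi.sub_apply, Pi.mul_apply, hGdef, Pi.smul_apply, smul_eq_mul, sub_nonneg]
    exact le_min (by nlinarith [hψ0 x, hsδ x]) (by nlinarith [hψ1 x, hs0 x])
  · refine ⟨(hs0 x).lt_of_ne fun h0 => hx ?_, (hsδ x).lt_of_ne fun h0 => hx ?_⟩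
    · simp [hGdef, ← h0, mul_nonneg hδ.le (hψ0 x)]
    · simp only [Pi.sub_apply, Pi.mul_apply, hGdef, Pi.smul_apply, smul_eq_mul, h0]
      rw [min_eq_left (by nlinarith [hψ1 x]), sub_self]
  · linarith [bilin_sub_self_le hG hsψ]
  · rw [add_sub_cancel]
    refine fin _ ?_
    rw [← hGg, h.add_right, h.symm G g]
    linarith [h.nonneg _ hG]
  · rw [show δ • ψ - s * ψ - (G - s * ψ) = g by rw [← hGg]; ring]
    refine fin _ ?_
    rw [← hGg, h.add_right]
    linarith [h.nonneg _ hg]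

lemma multi_layer {δ X : ℝ} (hδ : 0 < δ) {ψ : EuclideanSpace ℝ (Fin d) → ℝ}
    (hψ : ψ ∈ h.dom) (hψ0 : ∀ x, 0 ≤ ψ x) (hψ1 : ∀ x, ψ x ≤ 1) (n : ℕ) :
    ∀ ξ ∈ h.dom, (∀ x, 0 ≤ ξ x) → (∀ x, ξ x ≤ n * δ) → h.bilin ξ ξ ≤ X →
    ∃ E ∈ h.dom, (∀ x, 0 ≤ E x) ∧ (∀ x, E x ≠ 0 → 0 < ξ x) ∧
      h.bilin E E ≤ n * (56 * (X + δ ^ 2 * h.bilin ψ ψ)) ∧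
      -(n * (δ ^ 2 * h.bilin ψ ψ + X + X / (2 * δ ^ 2))) ≤ h.bilin (ξ * ψ + E) ψ ∧
      -(n * (δ ^ 2 * h.bilin ψ ψ + X + X / (2 * δ ^ 2))) ≤
        h.bilin ((n * δ) • ψ - ξ * ψ - E) ψ := by
  induction n with
  | zero =>
    intro ξ hξ hξ0 hξ1 hX
    have hz : ξ = 0 := funext fun x => le_antisymm (by simpa using hξ1 x) (hξ0 x)
    exact ⟨0, hz ▸ hξ, by simp, by simp, by simp [h.zero_left], by simp [hz, h.zero_left],
      by simp [hz, h.zero_left]⟩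
  | succ n ih =>
    intro ξ hξ hξ0 hξ1 hX
    obtain ⟨hs, hsq⟩ := min_const_mem hδ.le hξ
    obtain ⟨hr, hrq⟩ := sub_const_posPart_mem hδ.le hξ
    have hsr := min_const_add_sub_const_posPart ξ δ
    obtain ⟨e, he, he0, hes, heq, he1, he2⟩ := single_layer hδ hψ hψ0 hψ1 hs
      (fun x => le_min (hξ0 x) hδ.le) (fun x => min_le_right _ _) (hsq.trans hX)
    obtain ⟨E, hE, hE0, hEs, hEq, hE1, hE2⟩ := ih _ hr (fun x => le_max_right _ _)
      (fun x => max_le (by have := hξ1 x; push_cast at this; linarith) (by positivity))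
      (hrq.trans hX)
    have hlt : ∀ x, E x ≠ 0 → δ < ξ x := fun x hx => by
      have := hEs x hx
      simpa using this
    have hdisj : h.bilin e E ≤ 0 := bilin_nonpos_of_disjoint he hE he0 hE0 fun x hx => by
      by_contra hne
      have := (hes x hne).2
      simp only [min_eq_right (hlt x hx).le, lt_irrefl] at this
    set s : EuclideanSpace ℝ (Fin d) → ℝ := fun x => min (ξ x) δ
    set r : EuclideanSpace ℝ (Fin d) → ℝ := fun x => max (ξ x - δ) 0
    refine ⟨e + E, h.dom_add he hE, fun x => add_nonneg (he0 x) (hE0 x), fun x hx => ?_,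
      ?_, ?_, ?_⟩
    · by_cases hEx : E x = 0
      · have hex : e x ≠ 0 := fun h0 => hx (by simp [h0, hEx])
        exact (hes x hex).1.trans_le (min_le_left _ _)
      · exact hδ.trans (hlt x hEx)
    · simp only [h.add_left, h.add_right, h.symm E e]
      push_cast
      linarith
    · rw [show ξ * ψ + (e + E) = (s * ψ + e) + (r * ψ + E) by rw [← hsr]; ring, h.add_left]
      push_cast
      linarith
    · rw [show (((n + 1 : ℕ) : ℝ) * δ) • ψ - ξ * ψ - (e + E)
        = (δ • ψ - s * ψ - e) + ((n * δ) • ψ - r * ψ - E) by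
          rw [← hsr]; ext x; simp; ring, h.add_left]
      push_cast
      linarith

lemma exists_lower_bound {ξ : EuclideanSpace ℝ (Fin d) → ℝ} {M η : ℝ} (hξ : ξ ∈ h.dom)
    (hξ0 : ∀ x, 0 ≤ ξ x) (hM : 0 < M) (hξM : ∀ x, ξ x ≤ M) (hη : 0 < η) :
    ∃ C, ∀ ψ ∈ h.dom, (∀ x, 0 ≤ ψ x) → (∀ x, ψ x ≤ 1) →
      -C - η * h.bilin ψ ψ ≤ h.bilin (ξ * ψ) ψ ∧
      -C - η * h.bilin ψ ψ ≤ h.bilin (M • ψ - ξ * ψ) ψ := by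
  obtain ⟨n, hn⟩ := exists_nat_gt (M ^ 2 * (1 + 28 / η) / (η / 2))
  have hn0 : (0 : ℝ) < n := lt_of_le_of_lt (by positivity) hn
  rw [div_lt_iff₀ (by positivity)] at hn
  set X := h.bilin ξ ξ with hXdef
  have hδ : 0 < M / n := by positivity
  have hnδ : n * (M / n) = M := by field_simp
  refine ⟨n * (X + X / (2 * (M / n) ^ 2)) + 28 * n * X / η, fun ψ hψ hψ0 hψ1 => ?_⟩
  obtain ⟨E, hE, -, -, hEq, hE1, hE2⟩ := multi_layer (X := X) hδ hψ hψ0 hψ1 n ξ hξ hξ0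
    (by simpa [hnδ] using hξM) le_rfl
  rw [hnδ, h.sub_left] at hE2
  rw [h.add_left] at hE1
  have hY := h.nonneg ψ hψ
  have c1 := neg_le_two_mul_bilin (inv_pos.2 hη) hE hψ
  have c2 := neg_le_two_mul_bilin (inv_pos.2 hη) hE (h.dom_smul (-1) hψ)
  simp only [h.smul_left, h.smul_right, inv_inv] at c1 c2
  have c3 := mul_le_mul_of_nonneg_left hEq (inv_nonneg.2 hη.le)
  have hsmall : n * (M / n) ^ 2 * (1 + 28 / η) ≤ η / 2 := by
    rw [show n * (M / n) ^ 2 * (1 + 28 / η) = M ^ 2 * (1 + 28 / η) / n by field_simp,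
      div_le_iff₀ hn0]
    linarith
  have c4 := mul_le_mul_of_nonneg_right hsmall hY
  set D := X / (2 * (M / n) ^ 2)
  have e1 : η⁻¹ * (n * (56 * (X + (M / n) ^ 2 * h.bilin ψ ψ))) =
      2 * (28 * n * X / η) + 2 * (n * (M / n) ^ 2 * (28 / η) * h.bilin ψ ψ) := by
    field_simp; ring
  rw [e1] at c3
  constructor <;> nlinarith

lemma truncated_nonneg_of_nonneg {ξ w : EuclideanSpace ℝ (Fin d) → ℝ} {c K : ℝ} (hK : 0 ≤ K)
    (hξ : ξ ∈ h.dom) (hw : ∀ x, w x = c * ξ x + K) (hw0 : ∀ x, 0 ≤ w x)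
    (hwm : ∀ f ∈ h.dom, ∀ L, (∀ x, |f x| ≤ L) → w * f ∈ h.dom)
    (hdiag : ∀ η, 0 < η → ∃ C, ∀ ψ ∈ h.dom, (∀ x, 0 ≤ ψ x) → (∀ x, ψ x ≤ 1) →
      -C - η * h.bilin ψ ψ ≤ h.bilin (w * ψ) ψ)
    {φ : EuclideanSpace ℝ (Fin d) → ℝ} (hφ : φ ∈ h.dom) (hφ0 : ∀ x, 0 ≤ φ x)
    {L : ℝ} (hφL : ∀ x, φ x ≤ L) :
    0 ≤ h.bilin (w * φ) φ - c / 2 * h.bilin ξ (φ * φ) := by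
  have step : ∀ η, 0 < η → ∃ C, ∀ ε, 0 < ε → ∀ n : ℕ, ∀ φ ∈ h.dom, (∀ x, 0 ≤ φ x) →
      (∀ x, φ x ≤ n * ε) → -(n * (C * ε ^ 2)) - η * h.bilin φ φ ≤
        h.bilin (w * φ) φ - c / 2 * h.bilin ξ (φ * φ) := by
    intro η hη
    obtain ⟨C, hC⟩ := hdiag (η / 2) (by positivity)
    refine ⟨C + c ^ 2 * h.bilin ξ ξ / (2 * η), fun ε hε n => ?_⟩
    have single : ∀ φ ∈ h.dom, (∀ x, 0 ≤ φ x) → (∀ x, φ x ≤ ε) →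
        -((C + c ^ 2 * h.bilin ξ ξ / (2 * η)) * ε ^ 2) - η * h.bilin φ φ ≤
          h.bilin (w * φ) φ - c / 2 * h.bilin ξ (φ * φ) := by
      intro φ hφ hφ0 hφε
      have h1 := hC (ε⁻¹ • φ) (h.dom_smul _ hφ)
        (fun x => mul_nonneg (inv_nonneg.2 hε.le) (hφ0 x))
        (fun x => by
          simp only [Pi.smul_apply, smul_eq_mul]
          rw [inv_mul_le_iff₀ hε]; simpa using hφε x)
      rw [show w * (ε⁻¹ • φ) = ε⁻¹ • (w * φ) by ext x; simp; ring] at h1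
      simp only [h.smul_left, h.smul_right] at h1
      have h1' := mul_le_mul_of_nonneg_left h1 (sq_nonneg ε)
      rw [show ε ^ 2 * (ε⁻¹ * (ε⁻¹ * h.bilin (w * φ) φ)) = h.bilin (w * φ) φ by field_simp,
        show ε ^ 2 * (-C - η / 2 * (ε⁻¹ * (ε⁻¹ * h.bilin φ φ))) =
          -(C * ε ^ 2) - η / 2 * h.bilin φ φ by field_simp] at h1'
      obtain ⟨h2, h3⟩ := mul_self_mem (L := ε) hφ
        fun x => abs_le.2 ⟨by linarith [hφ0 x], hφε x⟩
      have h4 := neg_le_two_mul_bilin (t := ε ^ 2 / η * 2) (by positivity)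
        (h.dom_smul (-c) hξ) h2
      simp only [h.smul_left, h.smul_right] at h4
      have h5 := mul_le_mul_of_nonneg_left h3 (by positivity : 0 ≤ (ε ^ 2 / η * 2)⁻¹)
      rw [show (ε ^ 2 / η * 2)⁻¹ * (4 * ε ^ 2 * h.bilin φ φ) = 2 * η * h.bilin φ φ by
        field_simp; ring] at h5
      have h6 : c ^ 2 * h.bilin ξ ξ / (2 * η) * ε ^ 2 * 4 =
        ε ^ 2 / η * 2 * (-c * (-c * h.bilin ξ ξ)) := by field_simp; ring
      nlinarith
    induction n with
    | zero =>
      intro φ hφ hφ0 hφ1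
      have hz : φ = 0 := funext fun x => le_antisymm (by simpa using hφ1 x) (hφ0 x)
      simp [hz, h.zero_left, h.zero_right]
    | succ n ih =>
      intro φ hφ hφ0 hφ1
      obtain ⟨hs, -⟩ := min_const_mem hε.le hφ
      obtain ⟨hr, -⟩ := sub_const_posPart_mem hε.le hφ
      have hsr := min_const_add_sub_const_posPart φ ε
      have hs0 : ∀ x, 0 ≤ min (φ x) ε := fun x => le_min (hφ0 x) hε.le
      have hr0 : ∀ x, 0 ≤ max (φ x - ε) 0 := fun x => le_max_right _ _
      have hr1 : ∀ x, max (φ x - ε) 0 ≤ n * ε := fun x =>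
        max_le (by have := hφ1 x; push_cast at this; linarith) (by positivity)
      have hs1 : ∀ x, min (φ x) ε ≤ ε := fun x => min_le_right _ _
      have hsr' : ∀ x, max (φ x - ε) 0 ≠ 0 → min (φ x) ε = ε := fun x hx => by
        refine min_eq_right (le_of_not_gt fun hlt => hx (max_eq_right (by linarith)))
      have i1 := single _ hs hs0 hs1
      have i2 := ih _ hr hr0 hr1
      set s : EuclideanSpace ℝ (Fin d) → ℝ := fun x => min (φ x) ε
      set r : EuclideanSpace ℝ (Fin d) → ℝ := fun x => max (φ x - ε) 0
      have hws : w * s ∈ h.dom := hwm s hs ε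
        fun x => abs_le.2 ⟨by linarith [hs0 x], hs1 x⟩
      have hwr : w * r ∈ h.dom := hwm r hr (n * ε)
        fun x => abs_le.2 ⟨by linarith [hr0 x, hr1 x], hr1 x⟩
      have p0 : 0 ≤ h.bilin s r := bilin_nonneg_of_eq_max hs hr hε.le hs1 hr0 hsr'
      have p1 : 0 ≤ h.bilin s (w * r) := bilin_nonneg_of_eq_max hs hwr hε.le hs1
        (fun x => mul_nonneg (hw0 x) (hr0 x)) (fun x hx => hsr' x (right_ne_zero_of_mul hx))
      have p2 : 0 ≤ h.bilin (w * s - (c * ε) • ξ) r := by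
        refine bilin_nonneg_of_eq_max (K := K * ε) (sub_mem hws (h.dom_smul _ hξ)) hr
          (by positivity) (fun x => ?_) hr0 (fun x hx => ?_)
        · simp only [Pi.sub_apply, Pi.mul_apply, Pi.smul_apply, smul_eq_mul]
          nlinarith [hw x, mul_nonneg (hw0 x) (sub_nonneg.2 (hs1 x))]
        · have : s x = ε := hsr' x hx
          simp only [Pi.sub_apply, Pi.mul_apply, Pi.smul_apply, smul_eq_mul, this, hw x]
          ring
      have esr : s * r = ε • r := by
        ext x
        by_cases hx : r x = 0
        · simp [hx]
        · have : s x = ε := hsr' x hx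
          simp [this]
      have esq : φ * φ = s * s + (2 * ε) • r + r * r := by
        rw [mul_smul, ← esr, ← hsr]
        ext x; simp; ring
      rw [h.sub_left, h.smul_left] at p2
      rw [esq, ← hsr, mul_add]
      simp only [h.add_left, h.add_right, h.smul_right, h.symm r s, h.symm (w * r) s]
      push_cast
      nlinarith
  have hφq := h.nonneg φ hφ
  have hL : 0 ≤ L := (hφ0 0).trans (hφL 0)
  refine le_of_forall_pos_le_add fun a ha => ?_
  obtain ⟨C, hC⟩ := step (a / 2 / (h.bilin φ φ + 1)) (by positivity)
  obtain ⟨n, hn⟩ := exists_nat_gt (|C| * (L + 1) ^ 2 / (a / 2))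
  have hn0 : (0 : ℝ) < n := lt_of_le_of_lt (by positivity) hn
  rw [div_lt_iff₀ (by positivity)] at hn
  have := hC ((L + 1) / n) (by positivity) n φ hφ hφ0 (fun x => by
    rw [mul_div_cancel₀ _ hn0.ne']; linarith [hφL x])
  have e1 : n * (C * ((L + 1) / n) ^ 2) ≤ a / 2 := by
    rw [show n * (C * ((L + 1) / n) ^ 2) = C * (L + 1) ^ 2 / n by field_simp, div_le_iff₀ hn0]
    have := mul_le_mul_of_nonneg_right (le_abs_self C) (sq_nonneg (L + 1))
    linarith
  have e2 : a / 2 / (h.bilin φ φ + 1) * h.bilin φ φ ≤ a / 2 := by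
    rw [div_mul_eq_mul_div, div_le_iff₀ (by positivity)]
    nlinarith
  linarith

lemma truncated_nonneg {ξ w : EuclideanSpace ℝ (Fin d) → ℝ} {c K : ℝ} (hK : 0 ≤ K)
    (hξ : ξ ∈ h.dom) (hw : ∀ x, w x = c * ξ x + K) (hw0 : ∀ x, 0 ≤ w x)
    (hwm : ∀ f ∈ h.dom, ∀ L, (∀ x, |f x| ≤ L) → w * f ∈ h.dom)
    (hdiag : ∀ η, 0 < η → ∃ C, ∀ ψ ∈ h.dom, (∀ x, 0 ≤ ψ x) → (∀ x, ψ x ≤ 1) →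
      -C - η * h.bilin ψ ψ ≤ h.bilin (w * ψ) ψ)
    {φ : EuclideanSpace ℝ (Fin d) → ℝ} (hφ : φ ∈ h.dom) {L : ℝ} (hφL : ∀ x, |φ x| ≤ L) :
    0 ≤ h.bilin (w * φ) φ - c / 2 * h.bilin ξ (φ * φ) := by
  obtain ⟨hp, -⟩ := posPart_mem hφ
  obtain ⟨hm, -⟩ := posPart_mem (h.dom_smul (-1) hφ)
  have hp0 : ∀ x, 0 ≤ max (φ x) 0 := fun x => le_max_right _ _
  have hm0 : ∀ x, 0 ≤ max (((-1 : ℝ) • φ) x) 0 := fun x => le_max_right _ _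
  have hL : 0 ≤ L := (abs_nonneg _).trans (hφL 0)
  have hpL : ∀ x, max (φ x) 0 ≤ L := fun x => max_le ((le_abs_self _).trans (hφL x)) hL
  have hmL : ∀ x, max (((-1 : ℝ) • φ) x) 0 ≤ L := fun x =>
    max_le (by simpa using (neg_le_abs _).trans (hφL x)) hL
  have hpm : ∀ x, max (((-1 : ℝ) • φ) x) 0 ≠ 0 → max (φ x) 0 = 0 := fun x hx => by
    refine max_eq_right (le_of_not_gt fun hlt => hx (max_eq_right ?_))
    simp [hlt.le]
  have hφe : φ = (fun x => max (φ x) 0) - fun x => max (((-1 : ℝ) • φ) x) 0 := by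
    ext x
    simp only [Pi.sub_apply, Pi.smul_apply, smul_eq_mul]
    rcases le_total (φ x) 0 with hx | hx
    · rw [max_eq_right hx, max_eq_left (by linarith)]; ring
    · rw [max_eq_left hx, max_eq_right (by linarith)]; ring
  have i1 := truncated_nonneg_of_nonneg hK hξ hw hw0 hwm hdiag hp hp0 hpL
  have i2 := truncated_nonneg_of_nonneg hK hξ hw hw0 hwm hdiag hm hm0 hmL
  set p : EuclideanSpace ℝ (Fin d) → ℝ := fun x => max (φ x) 0
  set m : EuclideanSpace ℝ (Fin d) → ℝ := fun x => max (((-1 : ℝ) • φ) x) 0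
  have hwp : w * p ∈ h.dom := hwm p hp L fun x => abs_le.2 ⟨by linarith [hp0 x], hpL x⟩
  have hwm' : w * m ∈ h.dom := hwm m hm L fun x => abs_le.2 ⟨by linarith [hm0 x], hmL x⟩
  have j1 : h.bilin (w * p) m ≤ 0 := bilin_nonpos_of_disjoint hwp hm
    (fun x => mul_nonneg (hw0 x) (hp0 x)) hm0 fun x hx => by
      have : p x = 0 := hpm x hx
      simp [this]
  have j2 : h.bilin p (w * m) ≤ 0 := bilin_nonpos_of_disjoint hp hwm' hp0
    (fun x => mul_nonneg (hw0 x) (hm0 x)) fun x hx => hpm x (right_ne_zero_of_mul hx)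
  have esq : φ * φ = p * p + m * m := by
    have : p * m = 0 := by
      ext x
      by_cases hx : m x = 0
      · simp [hx]
      · have : p x = 0 := hpm x hx
        simp [this]
    rw [hφe]
    linear_combination (-2 : EuclideanSpace ℝ (Fin d) → ℝ) * this
  rw [esq, hφe, mul_sub]
  simp only [h.add_right, h.sub_left, h.sub_right, h.symm (w * m) p]
  linarith

end DirichletForm

/-- For a Dirichlet form `h` and a fixed nonnegative bounded `ξ ∈ D(h)`, the
truncated form `h_ξ(φ,ψ) = (1/2)(h(ξφ,ψ) + h(φ,ξψ) − h(ξ,φψ))` satisfies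
`0 ≤ h_ξ(φ) ≤ ‖ξ‖_∞ h(φ)` for all bounded `φ ∈ D(h)`. -/
theorem stmt10 (d : ℕ) (h : DirichletForm d)
    (ξ : EuclideanSpace ℝ (Fin d) → ℝ) (hξdom : ξ ∈ h.dom) (hξpos : ∀ x, 0 ≤ ξ x)
    (hξbdd : BddAbove (Set.range fun x => |ξ x|)) :
    ∀ φ : EuclideanSpace ℝ (Fin d) → ℝ, φ ∈ h.dom →
      (BddAbove (Set.range fun x => |φ x|)) →
      (ξ * φ ∈ h.dom) → (φ * φ ∈ h.dom) →
      0 ≤ (1/2 : ℝ) * (h.bilin (ξ * φ) φ + h.bilin φ (ξ * φ) - h.bilin ξ (φ * φ)) ∧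
      (1/2 : ℝ) * (h.bilin (ξ * φ) φ + h.bilin φ (ξ * φ) - h.bilin ξ (φ * φ)) ≤
        (⨆ x, |ξ x|) * h.bilin φ φ := by
  intro φ hφ ⟨L, hL⟩ _ _
  have hφL : ∀ x, |φ x| ≤ L := fun x => hL ⟨x, rfl⟩
  have hξM : ∀ x, |ξ x| ≤ ⨆ x, |ξ x| := fun x => le_ciSup hξbdd x
  have hM0 : 0 ≤ ⨆ x, |ξ x| := (abs_nonneg _).trans (hξM 0)
  have hmul : ∀ f ∈ h.dom, ∀ L, (∀ x, |f x| ≤ L) → ξ * f ∈ h.dom := fun f hf L hfL =>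
    DirichletForm.mul_mem_of_bounded hξdom hf hξM hfL
  rw [h.symm φ (ξ * φ)]
  have bound : ∀ M, (⨆ x, |ξ x|) < M → 0 < M ∧ ∀ x, ξ x ≤ M := fun M hM =>
    ⟨hM0.trans_lt hM, fun x => (le_abs_self _).trans ((hξM x).trans hM.le)⟩
  constructor
  · have := DirichletForm.truncated_nonneg (h := h) (w := ξ) (c := 1) le_rfl hξdom (by simp)
      hξpos hmul (fun η hη => by
        obtain ⟨hM, hle⟩ := bound _ (lt_add_one _)
        obtain ⟨C, hC⟩ := DirichletForm.exists_lower_bound hξdom hξpos hM hle hη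
        exact ⟨C, fun ψ h1 h2 h3 => (hC ψ h1 h2 h3).1⟩) hφ hφL
    linarith
  · have hq := h.nonneg φ hφ
    refine le_of_forall_pos_le_add fun a ha => ?_
    set M := (⨆ x, |ξ x|) + a / (h.bilin φ φ + 1) with hMdef
    obtain ⟨hM, hle⟩ := bound M (lt_add_of_pos_right _ (by positivity))
    have e : ∀ f, (fun x => M - ξ x) * f = M • f - ξ * f := fun f => by
      ext x; simp; ring
    have := DirichletForm.truncated_nonneg (h := h) (w := fun x => M - ξ x) (c := -1) hM.le hξdom
      (fun x => by ring) (fun x => sub_nonneg.2 (hle x))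
      (fun f hf L hfL => by
        rw [e]; exact DirichletForm.sub_mem (h.dom_smul _ hf) (hmul f hf L hfL))
      (fun η hη => by
        obtain ⟨C, hC⟩ := DirichletForm.exists_lower_bound hξdom hξpos hM hle hη
        exact ⟨C, fun ψ h1 h2 h3 => by rw [e]; exact (hC ψ h1 h2 h3).2⟩) hφ hφL
    rw [e, h.sub_left, h.smul_left] at this
    have e2 : a / (h.bilin φ φ + 1) * h.bilin φ φ ≤ a := by
      rw [div_mul_eq_mul_div, div_le_iff₀ (by positivity)]
      nlinarith
    rw [hMdef, add_mul] at this
    linarith
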